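/- Let R be a commutative ring. The following are equivalent: (1) every R-module is τ_q-flat (R is a τ_q-VN regular ring); (2) for every finitely generated ideal K of R there exists a finitely generated semi-regular ideal I of R with I·K = K²; (3) T(R[x]) is a von Neumann regular ring. -/

import Mathlib

open Polynomial TensorProduct

universe u v

/-- An ideal is *semi-regular* if it contains a finitely generated dense subideal
(an ideal is *dense* if its annihilator is zero). -/
def Ideal.IsSemiregular {R : Type*} [CommRing R] (I : Ideal R) : Prop :=
  ∃ J : Ideal R, J ≤ I ∧ J.FG ∧ Submodule.annihilator J = ⊥

/-- A module is *Q-torsion* if every element is annihilated by some finitely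
generated semi-regular ideal. -/
def IsQTorsion (R : Type*) (M : Type*) [CommRing R] [AddCommGroup M] [Module R M] : Prop :=
  ∀ m : M, ∃ I : Ideal R, I.FG ∧ I.IsSemiregular ∧ ∀ a ∈ I, a • m = 0

open CategoryTheory in
/-- `Tor_1^R(M, N)` as an `R`-module. -/
noncomputable def Tor1Mod (R : Type u) [CommRing R] (M N : Type u)
    [AddCommGroup M] [Module R M] [AddCommGroup N] [Module R N] : ModuleCat R :=
  ((Tor (ModuleCat.{u} R) 1).obj (ModuleCat.of R M)).obj (ModuleCat.of R N)

/-- A module is *τ_q-flat* if `Tor_1^R(M, N)` is Q-torsion for every module `N`. -/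
def IsTauQFlat (R : Type u) [CommRing R] (M : Type u) [AddCommGroup M] [Module R M] : Prop :=
  ∀ (N : Type u) [AddCommGroup N] [Module R N], IsQTorsion R (Tor1Mod R M N)

theorem flat_of_vonNeumannRegular {T : Type u} [CommRing T] (hT : ∀ a : T, ∃ b, a = a * b * a)
    (M : Type u) [AddCommGroup M] [Module T M] : Module.Flat T M := by
  refine Module.Flat.iff_rTensor_injective.mpr fun I hI => ?_
  have hidem : IsIdempotentElem I := by
    refine le_antisymm Ideal.mul_le_right fun a ha => ?_
    obtain ⟨b, hb⟩ := hT a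
    rw [hb]
    exact Ideal.mul_mem_mul (I.mul_mem_right b ha) ha
  obtain ⟨e, he, rfl⟩ := (Ideal.isIdempotentElem_iff_of_fg I hI).mp hidem
  let r : T →ₗ[T] Submodule.span T {e} :=
    LinearMap.codRestrict _ (LinearMap.mulLeft T e) fun x => by
      simpa using Ideal.mul_mem_right x _ (Ideal.mem_span_singleton_self e)
  have hr : r ∘ₗ Submodule.subtype (Submodule.span T {e}) = LinearMap.id := by
    ext ⟨x, hx⟩
    obtain ⟨c, rfl⟩ := Ideal.mem_span_singleton'.mp hx
    simp only [r, LinearMap.coe_comp, Function.comp_apply, Submodule.subtype_apply,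
      LinearMap.codRestrict_apply, LinearMap.mulLeft_apply, LinearMap.id_apply]
    rw [mul_left_comm, he.eq]
  refine Function.LeftInverse.injective (g := r.rTensor M) fun x => ?_
  rw [← LinearMap.comp_apply, ← LinearMap.rTensor_comp, hr, LinearMap.rTensor_id,
    LinearMap.id_apply]

section

variable {R : Type u} [CommRing R]

theorem exists_mem_nonZeroDivisors_of_one_tmul_eq_zero {P : Type u} [AddCommGroup P] [Module R P]
    (z : P) (hz : (1 : FractionRing R[X]) ⊗ₜ[R] z = 0) :
    ∃ h ∈ nonZeroDivisors R[X], h ⊗ₜ[R] z = 0 := by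
  have h0 : (1 : FractionRing R[X]) ⊗ₜ[R[X]] ((1 : R[X]) ⊗ₜ[R] z) = 0 := by
    rw [← AlgebraTensorModule.cancelBaseChange_symm_tmul R R[X] R[X], hz, map_zero]
  have := (IsLocalizedModule.eq_zero_iff (nonZeroDivisors R[X])
    (TensorProduct.mk R[X] (FractionRing R[X]) (R[X] ⊗[R] P) 1)).mp h0
  obtain ⟨⟨h, hh⟩, hz'⟩ := this
  refine ⟨h, hh, ?_⟩
  simpa [TensorProduct.smul_tmul', Submonoid.smul_def] using hz'

theorem coeff_smul_eq_zero_of_tmul_eq_zero {P : Type u} [AddCommGroup P] [Module R P]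
    {h : R[X]} {z : P} (hz : h ⊗ₜ[R] z = 0) (n : ℕ) : h.coeff n • z = 0 := by
  have := congrArg (fun x => TensorProduct.lid R P ((lcoeff R n).rTensor P x)) hz
  simpa using this

theorem annihilator_contentIdeal_eq_bot {h : R[X]} :
    Submodule.annihilator h.contentIdeal = ⊥ ↔ h ∈ nonZeroDivisors R[X] := by
  rw [Polynomial.mem_nonZeroDivisors_iff, eq_bot_iff]
  have key (r : R) : r ∈ Submodule.annihilator h.contentIdeal ↔ r • h = 0 := by
    rw [contentIdeal_def, Ideal.span, Submodule.mem_annihilator_span, Polynomial.ext_iff]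
    simp only [coeff_smul, coeff_zero]
    constructor
    · intro H n
      by_cases hn : h.coeff n = 0
      · simp [hn]
      · exact H ⟨_, coeff_mem_coeffs hn⟩
    · rintro H ⟨a, ha⟩
      obtain ⟨n, -, rfl⟩ := mem_coeffs_iff.mp ha
      exact H n
  exact forall_congr' fun r => by rw [key, Ideal.mem_bot]

open CategoryTheory in
theorem isQTorsion_homology_iff (S : ShortComplex (ModuleCat.{u} R)) :
    IsQTorsion R S.homology ↔ ∀ z : S.X₂, S.g z = 0 →
      ∃ I : Ideal R, I.FG ∧ I.IsSemiregular ∧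
        ∀ a ∈ I, a • z ∈ LinearMap.range S.f.hom := by
  let e : (LinearMap.ker S.g.hom ⧸ LinearMap.range S.moduleCatToCycles) ≃ₗ[R] S.homology :=
    S.moduleCatHomologyIso.toLinearEquiv.symm
  have key (z : LinearMap.ker S.g.hom) (a : R) :
      a • e ((LinearMap.range S.moduleCatToCycles).mkQ z) = 0 ↔
      a • z.1 ∈ LinearMap.range S.f.hom := by
    rw [← map_smul, LinearEquiv.map_eq_zero_iff, ← map_smul, Submodule.mkQ_apply,
      Submodule.Quotient.mk_eq_zero]
    exact exists_congr fun y => Subtype.ext_iff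
  constructor
  · intro h z hz
    obtain ⟨I, hI, hI', h⟩ := h (e ((LinearMap.range S.moduleCatToCycles).mkQ ⟨z, hz⟩))
    exact ⟨I, hI, hI', fun a ha => (key ⟨z, hz⟩ a).mp (h a ha)⟩
  · intro h x
    obtain ⟨y, rfl⟩ := e.surjective x
    obtain ⟨z, rfl⟩ := Submodule.mkQ_surjective _ y
    obtain ⟨I, hI, hI', h⟩ := h z.1 z.2
    exact ⟨I, hI, hI', fun a ha => (key z a).mpr (h a ha)⟩

theorem isQTorsion_congr {M N : Type*} [AddCommGroup M] [Module R M] [AddCommGroup N]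
    [Module R N] (e : M ≃ₗ[R] N) : IsQTorsion R M ↔ IsQTorsion R N := by
  refine e.toEquiv.forall_congr fun m => ?_
  simp [← map_smul]

open CategoryTheory in
theorem isQTorsion_tor1Mod_iff (M : Type u) [AddCommGroup M] [Module R M] (N : Type u)
    [AddCommGroup N] [Module R N] (P : ProjectiveResolution (ModuleCat.of R N)) :
    IsQTorsion R (Tor1Mod R M N) ↔ ∀ z : M ⊗[R] P.complex.X 1,
      (P.complex.d 1 0).hom.lTensor M z = 0 → ∃ I : Ideal R, I.FG ∧ I.IsSemiregular ∧
        ∀ a ∈ I, a • z ∈ LinearMap.range ((P.complex.d 2 1).hom.lTensor M) := by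
  let e : Tor1Mod R M N ≅ _ := P.isoLeftDerivedObj
    ((MonoidalCategory.tensoringLeft (ModuleCat R)).obj (ModuleCat.of R M)) 1 ≪≫
    HomologicalComplex.homologyIsoSc' _ 2 1 0 (by simp) (by simp)
  exact (isQTorsion_congr e.toLinearEquiv).trans (isQTorsion_homology_iff _)

theorem Ideal.FG.exists_contentIdeal_eq {K : Ideal R} (hK : K.FG) :
    ∃ f : R[X], f.contentIdeal = K := by
  classical
  obtain ⟨n, s, rfl⟩ := Submodule.fg_iff_exists_fin_generating_family.mp hK
  refine ⟨ofFn n s, le_antisymm ?_ ?_⟩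
  · rw [contentIdeal_def, Ideal.span_le]
    intro a ha
    obtain ⟨i, -, rfl⟩ := mem_coeffs_iff.mp ha
    by_cases hi : i < n
    · rw [ofFn_coeff_eq_val_of_lt _ hi]
      exact Submodule.subset_span ⟨_, rfl⟩
    · rw [ofFn_coeff_eq_zero_of_ge _ (not_lt.mp hi)]
      exact zero_mem _
  · rw [Submodule.span_le]
    rintro _ ⟨i, rfl⟩
    rw [← Fin.eta i i.2, ← ofFn_coeff_eq_val_of_lt s i.2]
    exact coeff_mem_contentIdeal _ _

theorem Ideal.FG.isSemiregular_iff {I : Ideal R} (hI : I.FG) :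
    I.IsSemiregular ↔ Submodule.annihilator I = ⊥ :=
  ⟨fun ⟨_, hJI, _, hJ⟩ => eq_bot_iff.mpr (hJ ▸ Submodule.annihilator_mono hJI),
    fun h => ⟨I, le_rfl, hI, h⟩⟩

theorem isSemiregular_contentIdeal {h : R[X]} (hh : h ∈ nonZeroDivisors R[X]) :
    h.contentIdeal.IsSemiregular :=
  (h.contentIdeal_FG.isSemiregular_iff).mpr (annihilator_contentIdeal_eq_bot.mpr hh)

theorem contentIdeal_mul_contentIdeal_eq_bot [IsReduced R] {f g : R[X]} (h : f * g = 0) :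
    f.contentIdeal * g.contentIdeal = ⊥ := by
  have := mul_contentIdeal_le_radical_contentIdeal_mul (p := f) (q := g)
  rw [h, contentIdeal_zero] at this
  have hrad : (⊥ : Ideal R).radical = ⊥ := nilradical_eq_zero R
  rwa [hrad, le_bot_iff] at this

theorem isReduced_of_vonNeumannRegular {T : Type*} [CommRing T]
    (hT : ∀ a : T, ∃ b, a = a * b * a) : IsReduced T := by
  refine (isReduced_iff_pow_one_lt 2 one_lt_two).mpr fun x hx => ?_
  obtain ⟨b, hb⟩ := hT x
  rw [hb, mul_right_comm, ← sq, hx, zero_mul]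

theorem exists_isSemiregular_mul_eq_sq_of_vonNeumannRegular
    (hT : ∀ a : FractionRing R[X], ∃ b, a = a * b * a) (K : Ideal R) (hK : K.FG) :
    ∃ I : Ideal R, I.FG ∧ I.IsSemiregular ∧ I * K = K ^ 2 := by
  have := isReduced_of_vonNeumannRegular hT
  have : IsReduced R[X] :=
    isReduced_of_injective _ (IsFractionRing.injective R[X] (FractionRing R[X]))
  have : IsReduced R := isReduced_of_injective (C : R →+* R[X]) C_injective
  obtain ⟨f, rfl⟩ := hK.exists_contentIdeal_eq
  obtain ⟨b, hb⟩ := hT (algebraMap _ _ f)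
  obtain ⟨p, ⟨q, hq⟩, rfl⟩ := IsLocalization.exists_mk'_eq (nonZeroDivisors R[X]) b
  have hf : f * q = f * f * p := by
    apply IsFractionRing.injective R[X] (FractionRing R[X])
    rw [map_mul, map_mul, map_mul]
    have hs := IsLocalization.mk'_spec (FractionRing R[X]) p ⟨q, hq⟩
    linear_combination (algebraMap R[X] (FractionRing R[X]) q) * hb +
      (algebraMap R[X] (FractionRing R[X]) f) ^ 2 * hs
  obtain ⟨g, hg⟩ : ∃ g, g = q - f * p := ⟨_, rfl⟩
  have hfg : f * g = 0 := by rw [hg]; linear_combination hf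
  have hreg : f + g ∈ nonZeroDivisors R[X] := by
    refine mem_nonZeroDivisors_iff_right.mpr fun h hh => ?_
    have hfh : f * h = 0 := by
      refine (pow_eq_zero_iff two_ne_zero).mp ?_
      linear_combination f * h * hh - h ^ 2 * hfg
    refine mem_nonZeroDivisors_iff_right.mp hq h ?_
    linear_combination hh + (p - 1) * hfh - h * hg
  have hle : (f + g).contentIdeal ≤ f.contentIdeal ⊔ g.contentIdeal := by
    rw [contentIdeal_def, Ideal.span_le]
    intro a ha
    obtain ⟨n, -, rfl⟩ := mem_coeffs_iff.mp ha
    rw [coeff_add]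
    exact Submodule.add_mem_sup (coeff_mem_contentIdeal f n) (coeff_mem_contentIdeal g n)
  refine ⟨f.contentIdeal ⊔ g.contentIdeal, Submodule.FG.sup f.contentIdeal_FG g.contentIdeal_FG,
    ⟨_, hle, contentIdeal_FG _, annihilator_contentIdeal_eq_bot.mpr hreg⟩, ?_⟩
  rw [Ideal.sup_mul, mul_comm g.contentIdeal, contentIdeal_mul_contentIdeal_eq_bot hfg,
    sup_bot_eq, sq]

theorem FractionRing.isUnit_of_forall_mul_algebraMap_eq_zero {A : Type*} [CommRing A]
    {w : FractionRing A} (hw : ∀ p : A, w * algebraMap A (FractionRing A) p = 0 → p = 0) :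
    IsUnit w := by
  obtain ⟨p, ⟨q, hq⟩, rfl⟩ := IsLocalization.exists_mk'_eq (nonZeroDivisors A) w
  rw [IsLocalization.mk'_eq_mul_mk'_one] at hw ⊢
  have hp : p ∈ nonZeroDivisors A := by
    refine mem_nonZeroDivisors_iff_right.mpr fun r hr => hw r ?_
    rw [mul_right_comm, ← map_mul, mul_comm p, hr, map_zero, zero_mul]
  refine (IsLocalization.map_units (FractionRing A) (⟨p, hp⟩ : nonZeroDivisors A)).mul ?_
  refine .of_mul_eq_one (algebraMap A _ q) ?_
  simp

theorem algebraMap_mem_map_contentIdeal (f : R[X]) {T : Type*} [CommRing T] [Algebra R T]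
    [Algebra R[X] T] [IsScalarTower R R[X] T] :
    algebraMap R[X] T f ∈ f.contentIdeal.map (algebraMap R T) := by
  rw [IsScalarTower.algebraMap_eq R R[X] T, ← Ideal.map_map]
  exact Ideal.mem_map_of_mem _ (Ideal.mem_map_C_iff.mpr (coeff_mem_contentIdeal f))

theorem isReduced_of_exists_isSemiregular_mul_eq_sq
    (h : ∀ K : Ideal R, K.FG → ∃ I : Ideal R, I.FG ∧ I.IsSemiregular ∧ I * K = K ^ 2) :
    IsReduced R := by
  refine (isReduced_iff_pow_one_lt 2 one_lt_two).mpr fun x hx => ?_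
  obtain ⟨I, hI, hI', hIK⟩ := h (Ideal.span {x}) (Submodule.fg_span_singleton x)
  rw [Ideal.span_singleton_pow, hx, Ideal.span_singleton_zero] at hIK
  have : x ∈ Submodule.annihilator I := by
    refine Submodule.mem_annihilator.mpr fun a ha => ?_
    rw [smul_eq_mul, mul_comm, ← Ideal.mem_bot, ← hIK]
    exact Ideal.mul_mem_mul ha (Ideal.mem_span_singleton_self x)
  rwa [hI.isSemiregular_iff.mp hI', Ideal.mem_bot] at this

theorem vonNeumannRegular_of_exists_isSemiregular_mul_eq_sq
    (h : ∀ K : Ideal R, K.FG → ∃ I : Ideal R, I.FG ∧ I.IsSemiregular ∧ I * K = K ^ 2)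
    (a : FractionRing R[X]) : ∃ b, a = a * b * a := by
  have := isReduced_of_exists_isSemiregular_mul_eq_sq h
  obtain ⟨f, ⟨q, hq⟩, rfl⟩ := IsLocalization.exists_mk'_eq (nonZeroDivisors R[X]) a
  obtain ⟨I, hI, hI', hIK⟩ := h f.contentIdeal f.contentIdeal_FG
  have hItop : I.map (algebraMap R (FractionRing R[X])) = ⊤ := by
    obtain ⟨i, rfl⟩ := hI.exists_contentIdeal_eq
    have hi := annihilator_contentIdeal_eq_bot.mp (hI.isSemiregular_iff.mp hI')
    exact Ideal.eq_top_of_isUnit_mem _ (algebraMap_mem_map_contentIdeal i)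
      (IsLocalization.map_units (FractionRing R[X]) (⟨i, hi⟩ : nonZeroDivisors R[X]))
  have hidem : IsIdempotentElem (f.contentIdeal.map (algebraMap R (FractionRing R[X]))) := by
    have := congrArg (Ideal.map (algebraMap R (FractionRing R[X]))) hIK
    rw [Ideal.map_mul, hItop, Ideal.top_mul, sq, Ideal.map_mul] at this
    exact this.symm
  obtain ⟨e, he, hKe⟩ := (Ideal.isIdempotentElem_iff_of_fg _ (f.contentIdeal_FG.map _)).mp hidem
  obtain ⟨F, hF⟩ : ∃ F, F = algebraMap R[X] (FractionRing R[X]) f := ⟨_, rfl⟩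
  have hfe : F * e = F := by
    have := algebraMap_mem_map_contentIdeal f (T := FractionRing R[X])
    rw [hKe, ← hF] at this
    obtain ⟨c, rfl⟩ := Ideal.mem_span_singleton'.mp this
    rw [mul_assoc, he.eq]
  have hunit : IsUnit (F + (1 - e)) := by
    refine FractionRing.isUnit_of_forall_mul_algebraMap_eq_zero fun p hp => ?_
    apply IsFractionRing.injective R[X] (FractionRing R[X])
    rw [map_zero]
    obtain ⟨P, hP⟩ : ∃ P, P = algebraMap R[X] (FractionRing R[X]) p := ⟨_, rfl⟩
    rw [← hP] at hp ⊢
    have hFP : F * P = 0 := by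
      linear_combination e * hp + P * he.eq - P * hfe
    have hfp : f * p = 0 := by
      apply IsFractionRing.injective R[X] (FractionRing R[X])
      rw [map_mul, map_zero, ← hF, ← hP, hFP]
    have hle : f.contentIdeal.map (algebraMap R (FractionRing R[X])) ≤
        Submodule.annihilator (Ideal.span {P}) := by
      refine Ideal.map_le_iff_le_comap.mpr fun k hk => ?_
      rw [Ideal.mem_comap, Ideal.span, Submodule.mem_annihilator_span_singleton, smul_eq_mul, hP,
        IsScalarTower.algebraMap_apply R R[X], ← map_mul]
      convert map_zero (algebraMap R[X] (FractionRing R[X]))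
      ext n
      rw [← C_eq_algebraMap, coeff_C_mul, coeff_zero, ← Ideal.mem_bot,
        ← contentIdeal_mul_contentIdeal_eq_bot hfp]
      exact Ideal.mul_mem_mul hk (coeff_mem_contentIdeal p n)
    have heP : e * P = 0 := by
      have : e ∈ Submodule.annihilator (Ideal.span {P}) :=
        hle (hKe ▸ Ideal.mem_span_singleton_self e)
      rwa [Ideal.span, Submodule.mem_annihilator_span_singleton] at this
    linear_combination hp - hFP + heP
  obtain ⟨v, hv⟩ := hunit.exists_right_inv
  refine ⟨v * algebraMap R[X] _ q, ?_⟩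
  rw [IsLocalization.mk'_eq_mul_mk'_one, ← hF]
  have hs := IsLocalization.mk'_spec (FractionRing R[X]) 1 (⟨q, hq⟩ : nonZeroDivisors R[X])
  rw [map_one] at hs
  obtain ⟨s, hs'⟩ : ∃ s, s = IsLocalization.mk' (FractionRing R[X]) 1
    (⟨q, hq⟩ : nonZeroDivisors R[X]) := ⟨_, rfl⟩
  rw [← hs'] at hs ⊢
  have hFv : F * F * v = F := by linear_combination F * hv + v * hfe
  linear_combination (-s) * hFv - F * F * v * s * hs

theorem exists_isSemiregular_smul_mem_range (hT : ∀ a : FractionRing R[X], ∃ b, a = a * b * a)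
    (M : Type u) [AddCommGroup M] [Module R M] {P₂ P₁ P₀ : Type u} [AddCommGroup P₂]
    [Module R P₂] [AddCommGroup P₁] [Module R P₁] [AddCommGroup P₀] [Module R P₀]
    {f : P₂ →ₗ[R] P₁} {g : P₁ →ₗ[R] P₀} (hfg : Function.Exact f g) (z : M ⊗[R] P₁)
    (hz : g.lTensor M z = 0) :
    ∃ I : Ideal R, I.FG ∧ I.IsSemiregular ∧ ∀ a ∈ I, a • z ∈ LinearMap.range (f.lTensor M) := by
  have := flat_of_vonNeumannRegular hT (FractionRing R[X] ⊗[R] M)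
  have : Module.Flat R[X] (FractionRing R[X]) :=
    IsLocalization.flat _ (nonZeroDivisors R[X])
  have : Module.Flat R (FractionRing R[X]) := Module.Flat.trans R R[X] _
  have : Module.Flat R (FractionRing R[X] ⊗[R] M) := Module.Flat.trans R (FractionRing R[X]) _
  have hex := Module.Flat.lTensor_exact (FractionRing R[X] ⊗[R] M) hfg
  have hz' : g.lTensor (FractionRing R[X] ⊗[R] M)
      ((TensorProduct.assoc R _ _ _).symm ((1 : FractionRing R[X]) ⊗ₜ z)) = 0 := by
    rw [LinearMap.lTensor_tensor]
    simp [hz]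
  obtain ⟨y, hy⟩ := (hex _).mp hz'
  rw [LinearMap.lTensor_tensor] at hy
  simp only [LinearMap.comp_apply, LinearEquiv.coe_coe, EmbeddingLike.apply_eq_iff_eq] at hy
  have hzero : (1 : FractionRing R[X]) ⊗ₜ[R] (LinearMap.range (f.lTensor M)).mkQ z = 0 := by
    rw [← LinearMap.lTensor_tmul, ← hy, ← LinearMap.comp_apply, ← LinearMap.lTensor_comp,
      LinearMap.range_mkQ_comp, LinearMap.lTensor_zero, LinearMap.zero_apply]
  obtain ⟨h, hh, hhz⟩ := exists_mem_nonZeroDivisors_of_one_tmul_eq_zero _ hzero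
  refine ⟨h.contentIdeal, h.contentIdeal_FG, isSemiregular_contentIdeal hh, fun a ha => ?_⟩
  rw [← Submodule.Quotient.mk_eq_zero, Submodule.Quotient.mk_smul]
  have hle : h.contentIdeal ≤ LinearMap.ker (LinearMap.toSpanSingleton R _
      ((LinearMap.range (f.lTensor M)).mkQ z)) := by
    rw [contentIdeal_def, Ideal.span_le]
    intro b hb
    obtain ⟨n, -, rfl⟩ := mem_coeffs_iff.mp hb
    exact coeff_smul_eq_zero_of_tmul_eq_zero hhz n
  exact hle ha

open CategoryTheory in
theorem isTauQFlat_of_vonNeumannRegular (hT : ∀ a : FractionRing R[X], ∃ b, a = a * b * a)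
    (M : Type u) [AddCommGroup M] [Module R M] : IsTauQFlat R M := by
  intro N _ _
  let P := projectiveResolution (ModuleCat.of R N)
  refine (isQTorsion_tor1Mod_iff M N P).mpr ?_
  exact exists_isSemiregular_smul_mem_range hT M
    ((ShortComplex.ShortExact.moduleCat_exact_iff_function_exact _).mp (P.exact_succ 0))

open CategoryTheory in
theorem exists_isSemiregular_mul_mem_sq_of_isTauQFlat
    {K : Ideal R} (h : IsTauQFlat R (R ⧸ K)) {k : R} (hk : k ∈ K) :
    ∃ I : Ideal R, I.FG ∧ I.IsSemiregular ∧ ∀ a ∈ I, a * k ∈ K ^ 2 := by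
  let P := projectiveResolution (ModuleCat.of R (R ⧸ K))
  have hP := (isQTorsion_tor1Mod_iff (R ⧸ K) (R ⧸ K) P).mp (h (R ⧸ K))
  let ε : P.complex.X 0 →ₗ[R] R ⧸ K := (P.π.f 0).hom
  have hε : Function.Surjective ε := (ModuleCat.epi_iff_surjective (P.π.f 0)).mp inferInstance
  have hex : Function.Exact (P.complex.d 1 0).hom ε :=
    (ShortComplex.ShortExact.moduleCat_exact_iff_function_exact _).mp P.exact₀
  obtain ⟨φ, hφ⟩ := Module.projective_lifting_property K.mkQ ε K.mkQ_surjective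
  replace hφ (x) : Submodule.Quotient.mk (φ x) = ε x := LinearMap.congr_fun hφ x
  have hφK (y : P.complex.X 1) : φ ((P.complex.d 1 0).hom y) ∈ K := by
    rw [← Submodule.Quotient.mk_eq_zero K, hφ]
    exact hex.apply_apply_eq_zero y
  obtain ⟨p₀, hp₀⟩ := hε (Submodule.Quotient.mk 1)
  obtain ⟨p₁, hp₁⟩ : ∃ p₁, (P.complex.d 1 0).hom p₁ = k • p₀ := by
    refine (hex _).mp ?_
    rw [map_smul, hp₀, ← Submodule.Quotient.mk_smul, Submodule.Quotient.mk_eq_zero]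
    exact K.mul_mem_right 1 hk
  obtain ⟨I, hI, hI', hI''⟩ := hP (Submodule.Quotient.mk 1 ⊗ₜ p₁) (by
    rw [LinearMap.lTensor_tmul, hp₁, ← smul_tmul, ← Submodule.Quotient.mk_smul, smul_eq_mul,
      (Submodule.Quotient.mk_eq_zero K).mpr (K.mul_mem_right 1 hk), zero_tmul])
  refine ⟨I, hI, hI', fun a ha => ?_⟩
  let δ : P.complex.X 1 →ₗ[R] R ⧸ K ^ 2 := (K ^ 2).mkQ ∘ₗ φ ∘ₗ (P.complex.d 1 0).hom
  let ψ : (R ⧸ K) ⊗[R] P.complex.X 1 →ₗ[R] R ⧸ K ^ 2 :=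
    TensorProduct.lift (Submodule.liftQ K (LinearMap.toSpanSingleton R _ δ) fun c hc => by
      ext y
      refine (Submodule.Quotient.mk_eq_zero (K ^ 2)).mpr ?_
      rw [sq]
      exact Ideal.mul_mem_mul hc (hφK y))
  have hψ (y) : ψ (Submodule.Quotient.mk 1 ⊗ₜ y) = δ y := by
    change (1 : R) • δ y = δ y
    rw [one_smul]
  have hψd : ψ ∘ₗ (P.complex.d 2 1).hom.lTensor (R ⧸ K) = 0 := by
    ext y
    change ψ (Submodule.Quotient.mk 1 ⊗ₜ (P.complex.d 2 1).hom y) = 0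
    rw [hψ]
    have := LinearMap.congr_fun (ModuleCat.hom_ext_iff.mp (P.complex.d_comp_d 2 1 0)) y
    change (K ^ 2).mkQ (φ ((P.complex.d 1 0).hom ((P.complex.d 2 1).hom y))) = 0
    exact (congrArg (fun x => (K ^ 2).mkQ (φ x)) this).trans (by simp)
  obtain ⟨w, hw⟩ := hI'' a ha
  have hmem : a * (k * φ p₀) ∈ K ^ 2 := by
    rw [← Submodule.Quotient.mk_eq_zero (K ^ 2)]
    have := LinearMap.congr_fun hψd w
    rw [LinearMap.comp_apply, hw, map_smul, hψ] at this
    change a • (K ^ 2).mkQ (φ ((P.complex.d 1 0).hom p₁)) = 0 at this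
    rwa [hp₁, map_smul φ] at this
  have hsub : 1 - φ p₀ ∈ K := by
    rw [← Submodule.Quotient.mk_eq_zero K, Submodule.Quotient.mk_sub, hφ, hp₀, sub_self]
  have hmem' : k * (1 - φ p₀) ∈ K ^ 2 := sq K ▸ Ideal.mul_mem_mul hk hsub
  convert add_mem hmem ((K ^ 2).mul_mem_left a hmem') using 1
  ring

theorem isSemiregular_top : (⊤ : Ideal R).IsSemiregular := by
  refine ⟨⊤, le_rfl, Module.Finite.fg_top, eq_bot_iff.mpr fun r hr => ?_⟩
  simpa using Submodule.mem_annihilator.mp hr 1 trivial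

theorem Ideal.IsSemiregular.mul {I J : Ideal R} (hI : I.IsSemiregular) (hJ : J.IsSemiregular) :
    (I * J).IsSemiregular := by
  obtain ⟨I', hI', hIfg, hIann⟩ := hI
  obtain ⟨J', hJ', hJfg, hJann⟩ := hJ
  refine ⟨I' * J', Ideal.mul_mono hI' hJ', hIfg.mul hJfg, eq_bot_iff.mpr fun r hr => ?_⟩
  rw [← hIann, Submodule.mem_annihilator]
  intro a ha
  rw [← Ideal.mem_bot, ← hJann, Submodule.mem_annihilator]
  intro b hb
  rw [smul_assoc]
  exact Submodule.mem_annihilator.mp hr _ (Ideal.mul_mem_mul ha hb)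

theorem exists_isSemiregular_mul_eq_sq_of_isTauQFlat
    {K : Ideal R} (h : IsTauQFlat R (R ⧸ K)) (hK : K.FG) :
    ∃ I : Ideal R, I.FG ∧ I.IsSemiregular ∧ I * K = K ^ 2 := by
  classical
  have key (s : Finset R) (hs : (s : Set R) ⊆ K) :
      ∃ I : Ideal R, I.FG ∧ I.IsSemiregular ∧ ∀ k ∈ s, ∀ a ∈ I, a * k ∈ K ^ 2 := by
    induction s using Finset.induction_on with
    | empty => exact ⟨⊤, Module.Finite.fg_top, isSemiregular_top, by simp⟩
    | insert k s _ ih =>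
      rw [Finset.coe_insert, Set.insert_subset_iff] at hs
      obtain ⟨I, hI, hI', hIs⟩ := ih hs.2
      obtain ⟨J, hJ, hJ', hJk⟩ := exists_isSemiregular_mul_mem_sq_of_isTauQFlat h hs.1
      refine ⟨I * J, hI.mul hJ, hI'.mul hJ', fun l hl a ha => ?_⟩
      obtain rfl | hl := Finset.mem_insert.mp hl
      · exact hJk a ((Ideal.mul_le_right : I * J ≤ J) ha)
      · exact hIs l hl a ((Ideal.mul_le_left : I * J ≤ I) ha)
  obtain ⟨s, hs⟩ := hK
  obtain ⟨I, hI, ⟨J, hJI, hJ⟩, hIs⟩ := key s (hs ▸ Submodule.subset_span)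
  refine ⟨I ⊔ K, Submodule.FG.sup hI ⟨s, hs⟩, ⟨J, hJI.trans le_sup_left, hJ⟩, ?_⟩
  rw [Ideal.sup_mul, ← sq, sup_eq_right, Ideal.mul_le]
  intro a ha k hk
  have hle : K ≤ Submodule.comap (LinearMap.mulLeft R a) (K ^ 2) := by
    rw [← hs]
    exact Submodule.span_le.mpr fun l hl => hs ▸ hIs l hl a ha
  exact hle hk

end

/-- For a commutative ring `R` the following are equivalent:
(1) every `R`-module is τ_q-flat (`R` is a τ_q-VN regular ring);
(2) for every finitely generated ideal `K` there is a finitely generated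
semi-regular ideal `I` with `I·K = K²`;
(3) `T(R[x])` is a von Neumann regular ring. -/
theorem statement14 (R : Type u) [CommRing R] :
    List.TFAE
      [∀ (M : Type u) [AddCommGroup M] [Module R M], IsTauQFlat R M,
      ∀ K : Ideal R, K.FG → ∃ I : Ideal R, I.FG ∧ I.IsSemiregular ∧ I * K = K ^ 2,
      ∀ a : FractionRing (Polynomial R), ∃ b, a = a * b * a] := by
  tfae_have 1 → 2 := fun h K hK => exists_isSemiregular_mul_eq_sq_of_isTauQFlat (h (R ⧸ K)) hK
  tfae_have 2 → 3 := vonNeumannRegular_of_exists_isSemiregular_mul_eq_sq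
  tfae_have 3 → 1 := fun h M _ _ => isTauQFlat_of_vonNeumannRegular h M
  tfae_finish
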